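/- Let Q_0 be a dyadic cube in ℝⁿ, let ε = {ε_Q}_{Q∈𝒟(Q_0)} be a collection of positive real numbers indexed by the dyadic subcubes of Q_0, bounded above and with the domination property, and let 0 < α < 1/2. Suppose lim_{N→∞} sup{ε_Q : Q ∈ 𝒟(Q_0), ℓ(Q) < 2^{-N}} = 0 and p is an exponent function on Q_0 with 1 < p_- ≤ p_+ < ∞ and p ∈ ε^αLH_0(Q_0). Then for every sparse collection 𝒮 ⊆ 𝒟(Q_0), the associated ε-sparse operator S_ε is a compact operator on L^{p(·)}(Q_0). -/

import Mathlib

open MeasureTheory Set ENNReal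

noncomputable section

/-- The dyadic cube in `ℝⁿ` with side length `2^(-k)` and lower-left corner `2^(-k) • m`. -/
def dyadicCube (n : ℕ) (k : ℤ) (m : Fin n → ℤ) : Set (Fin n → ℝ) :=
  {x | ∀ i, (2 : ℝ) ^ (-k) * m i ≤ x i ∧ x i < (2 : ℝ) ^ (-k) * (m i + 1)}

/-- `Q` is a dyadic cube in `ℝⁿ`. -/
def IsDyadicCube (n : ℕ) (Q : Set (Fin n → ℝ)) : Prop :=
  ∃ (k : ℤ) (m : Fin n → ℤ), Q = dyadicCube n k m

/-- `η_𝒮(Q)`: the maximal elements of the collection `S` strictly contained in `Q`. -/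
def sparseMaximals {α : Type*} (S : Set (Set α)) (Q : Set α) : Set (Set α) :=
  {P | P ∈ S ∧ P ⊂ Q ∧ ∀ R ∈ S, R ⊂ Q → P ⊆ R → P = R}

/-- A collection `S` of sets is sparse if `Σ_{P ∈ η_S(Q)} |P| ≤ |Q|/2` for all `Q ∈ S`. -/
def IsSparse {α : Type*} [MeasureSpace α] (S : Set (Set α)) : Prop :=
  ∀ Q ∈ S, (∑' P : (sparseMaximals S Q), volume (P : Set α)) ≤ volume Q / 2

/-- The ε-sparse operator `S_ε f (x) = Σ_{Q ∈ S} ε_Q (⨍_Q f) χ_Q(x)`. -/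
def sparseOp {α : Type*} [MeasureSpace α] (ε : Set α → ℝ) (S : Set (Set α))
    (f : α → ℝ) (x : α) : ℝ :=
  ∑' Q : S, (Q : Set α).indicator
    (fun _ => ε Q * (((volume (Q : Set α)).toReal)⁻¹ * ∫ y in (Q : Set α), f y ∂volume)) x

/-- The variable Lebesgue norm `‖f‖_{p(·)}` (valued in `ℝ≥0∞`; it is `∞` iff
`f ∉ L^{p(·)}`). -/
def varLpNorm {α : Type*} [MeasurableSpace α] (p : α → ℝ) (μ : Measure α)
    (f : α → ℝ) : ℝ≥0∞ :=
  sInf {l : ℝ≥0∞ | ∃ r : ℝ, 0 < r ∧ l = ENNReal.ofReal r ∧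
    ∫⁻ x, ENNReal.ofReal ((|f x| / r) ^ p x) ∂μ ≤ 1}

open Classical in
/-- The number of members of `F` strictly contained in `Q` that contain `x`. -/
def subCount {X : Type*} (F : Finset (Set X)) (Q : Set X) (x : X) : ℕ :=
  (F.filter fun P => P ⊂ Q ∧ x ∈ P).card

theorem subCount_lt_subCount {X : Type*} {F : Finset (Set X)} {P Q : Set X} {x : X}
    (hP : P ∈ F) (hPQ : P ⊂ Q) (hx : x ∈ P) : subCount F P x < subCount F Q x := by
  classical
  refine Finset.card_lt_card ?_
  rw [Finset.ssubset_iff_of_subset]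
  · exact ⟨P, by simp [hP, hPQ, hx], by simp⟩
  · intro R hR
    simp only [Finset.mem_filter] at hR ⊢
    exact ⟨hR.1, hR.2.1.trans hPQ, hR.2.2⟩

theorem measurable_subCount {X : Type*} [MeasurableSpace X] {F : Finset (Set X)}
    (hF : ∀ Q ∈ F, MeasurableSet Q) (Q : Set X) : Measurable (subCount F Q) := by
  classical
  have : subCount F Q = fun x => ∑ P ∈ F, if P ⊂ Q then P.indicator (fun _ => 1) x else 0 := by
    ext x
    simp only [subCount, Finset.card_filter]
    refine Finset.sum_congr rfl fun P _ => ?_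
    by_cases h1 : P ⊂ Q <;> by_cases h2 : x ∈ P <;> simp [h1, h2]
  rw [this]
  refine Finset.measurable_sum _ fun P hP => ?_
  by_cases h : P ⊂ Q
  · simpa [h] using measurable_const.indicator (hF P hP)
  · simp [h]

/-- Any two members of `F` are comparable or disjoint. -/
def IsNested {X : Type*} (F : Set (Set X)) : Prop :=
  ∀ P ∈ F, ∀ Q ∈ F, ∀ x ∈ P, x ∈ Q → P ⊆ Q ∨ Q ⊆ P

theorem sum_pow_subCount_le {X : Type*} {F : Finset (Set X)} (hF : IsNested (F : Set (Set X)))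
    (t : ℝ≥0∞) (x : X) :
    ∑ Q ∈ F, Q.indicator (fun x => t ^ subCount F Q x) x ≤ (1 - t)⁻¹ := by
  classical
  have h1 : ∑ Q ∈ F, Q.indicator (fun x => t ^ subCount F Q x) x
      = ∑ Q ∈ F.filter (x ∈ ·), t ^ subCount F Q x := by
    rw [Finset.sum_filter]
    exact Finset.sum_congr rfl fun Q _ => Set.indicator_apply _ _ _
  have hinj : Set.InjOn (fun Q => subCount F Q x) (F.filter (x ∈ ·) : Finset (Set X)) := by
    intro P hP Q hQ h
    simp only [Finset.coe_filter, Set.mem_ofPred_eq] at hP hQ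
    by_contra hne
    rcases hF P hP.1 Q hQ.1 x hP.2 hQ.2 with h' | h'
    · exact (subCount_lt_subCount hP.1 (h'.ssubset_of_ne hne) hP.2).ne h
    · exact (subCount_lt_subCount hQ.1 (h'.ssubset_of_ne (Ne.symm hne)) hQ.2).ne h.symm
  rw [h1, ← Finset.sum_image (f := fun k => t ^ k) hinj, ← ENNReal.tsum_geometric]
  exact ENNReal.sum_le_tsum _

theorem pow_subCount_le {X : Type*} {F : Finset (Set X)} (hF : IsNested (F : Set (Set X)))
    {Q : Set X} (t : ℝ≥0∞) {x : X} :
    t ^ subCount F Q x ≤ 1 + ∑' P : sparseMaximals (F : Set (Set X)) Q,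
      (P : Set X).indicator (fun x => t * t ^ subCount F P x) x := by
  classical
  rcases Nat.eq_zero_or_pos (subCount F Q x) with h0 | h0
  · simp [h0]
  · obtain ⟨P₀, hP₀⟩ := Finset.card_pos.1 h0
    obtain ⟨P, -, hP⟩ := Finset.exists_le_maximal _ hP₀
    have hPm := hP.prop
    simp only [Finset.mem_filter] at hPm
    obtain ⟨hPF, hPQ, hxP⟩ := hPm
    have hmax : P ∈ sparseMaximals (F : Set (Set X)) Q := by
      refine ⟨hPF, hPQ, fun R hR hRQ hPR => hPR.antisymm ?_⟩
      exact hP.le_of_ge (by simpa using ⟨hR, hRQ, hPR hxP⟩) hPR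
    have hcount : subCount F Q x = subCount F P x + 1 := by
      have : (F.filter fun R => R ⊂ Q ∧ x ∈ R) =
          insert P (F.filter fun R => R ⊂ P ∧ x ∈ R) := by
        ext R
        simp only [Finset.mem_filter, Finset.mem_insert]
        constructor
        · rintro ⟨hR, hRQ, hxR⟩
          by_cases hRP : R = P
          · exact Or.inl hRP
          · refine Or.inr ⟨hR, ?_, hxR⟩
            rcases hF R hR P hPF x hxR hxP with h | h
            · exact h.ssubset_of_ne hRP
            · exact absurd (h.antisymm (hP.le_of_ge (by simpa using ⟨hR, hRQ, hxR⟩) h)).symm hRP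
        · rintro (rfl | ⟨hR, hRP, hxR⟩)
          · exact ⟨hPF, hPQ, hxP⟩
          · exact ⟨hR, hRP.trans hPQ, hxR⟩
      rw [subCount, this, Finset.card_insert_of_notMem (by simp), subCount]
    calc t ^ subCount F Q x = P.indicator (fun x => t * t ^ subCount F P x) x := by
          rw [Set.indicator_of_mem hxP, hcount, pow_succ']
      _ ≤ ∑' P : sparseMaximals (F : Set (Set X)) Q,
            (P : Set X).indicator (fun x => t * t ^ subCount F P x) x :=
          ENNReal.le_tsum (f := fun P : sparseMaximals (F : Set (Set X)) Q =>
            (P : Set X).indicator (fun x => t * t ^ subCount F P x) x) ⟨P, hmax⟩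
      _ ≤ _ := le_add_self

/-- In a nested sparse family the overlap counting function is exponentially integrable. -/
theorem setLIntegral_pow_subCount_le {X : Type*} [MeasureSpace X] {F : Finset (Set X)}
    (hF : IsNested (F : Set (Set X))) (hFm : ∀ Q ∈ F, MeasurableSet Q)
    (hsp : IsSparse (F : Set (Set X))) {Q : Set X} (hQ : Q ∈ F) :
    ∫⁻ x in Q, (3 / 2 : ℝ≥0∞) ^ subCount F Q x ≤ 4 * volume Q := by
  classical
  induction hk : (F.filter (· ⊂ Q)).card using Nat.strong_induction_on generalizing Q with
  | _ k ih =>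
    have hmeas : ∀ P : Set X, Measurable fun x => (3 / 2 : ℝ≥0∞) * (3 / 2) ^ subCount F P x :=
      fun P => measurable_const.mul (measurable_from_top.comp (measurable_subCount hFm P))
    have : Finite (sparseMaximals (F : Set (Set X)) Q) :=
      (F.finite_toSet.subset fun P hP => hP.1).to_subtype
    calc ∫⁻ x in Q, (3 / 2 : ℝ≥0∞) ^ subCount F Q x
        ≤ ∫⁻ x in Q, (1 + ∑' P : sparseMaximals (F : Set (Set X)) Q,
          (P : Set X).indicator (fun x => (3 / 2) * (3 / 2) ^ subCount F P x) x) :=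
          lintegral_mono fun x => pow_subCount_le hF _
      _ = volume Q + ∑' P : sparseMaximals (F : Set (Set X)) Q, ∫⁻ x in Q,
          (P : Set X).indicator (fun x => (3 / 2) * (3 / 2) ^ subCount F P x) x := by
          rw [lintegral_add_left measurable_const, lintegral_tsum]
          · simp
          · exact fun P => ((hmeas P).indicator (hFm P P.2.1)).aemeasurable
      _ ≤ volume Q + ∑' P : sparseMaximals (F : Set (Set X)) Q, 6 * volume (P : Set X) := by
          gcongr with P
          calc ∫⁻ x in Q, (P : Set X).indicator (fun x => (3 / 2) * (3 / 2) ^ subCount F P x) x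
              ≤ ∫⁻ x, (P : Set X).indicator (fun x => (3 / 2) * (3 / 2) ^ subCount F P x) x :=
                setLIntegral_le_lintegral _ _
            _ = (3 / 2) * ∫⁻ x in (P : Set X), (3 / 2) ^ subCount F P x := by
                rw [lintegral_indicator (hFm P P.2.1), lintegral_const_mul]
                exact measurable_from_top.comp (measurable_subCount hFm P)
            _ ≤ (3 / 2) * (4 * volume (P : Set X)) := by
                gcongr
                refine ih _ ?_ P.2.1 rfl
                rw [← hk]
                refine Finset.card_lt_card ?_
                rw [Finset.ssubset_iff_of_subset]
                · exact ⟨P, Finset.mem_filter.2 ⟨P.2.1, P.2.2.1⟩, by simp⟩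
                · intro R hR
                  simp only [Finset.mem_filter] at hR ⊢
                  exact ⟨hR.1, hR.2.trans P.2.2.1⟩
            _ = 6 * volume (P : Set X) := by
                rw [← mul_assoc]
                congr 1
                rw [← ENNReal.toReal_eq_toReal_iff' (by finiteness) (by finiteness)]
                norm_num
      _ ≤ volume Q + 6 * (volume Q / 2) := by
          rw [ENNReal.tsum_mul_left]
          gcongr
          exact hsp Q hQ
      _ = 4 * volume Q := by
          have : (6 : ℝ≥0∞) * (volume Q / 2) = 3 * volume Q := by
            rw [div_eq_mul_inv, mul_comm (volume Q), ← mul_assoc]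
            congr 1
            rw [← ENNReal.toReal_eq_toReal_iff' (by finiteness) (by finiteness)]
            norm_num
          rw [this]
          ring

theorem three_halves_rpow_neg_lt_one {s : ℝ} (hs : 0 < s) : (3 / 2 : ℝ≥0∞) ^ (-s) < 1 := by
  rw [ENNReal.rpow_neg, ENNReal.inv_lt_one]
  refine ENNReal.one_lt_rpow ?_ hs
  rw [← ENNReal.toReal_lt_toReal (by finiteness) (by finiteness)]
  norm_num

/-- Carleson embedding for a nested sparse family. -/
theorem exists_carleson_embedding {q : ℝ} (hq : 1 < q) : ∃ K : ℝ≥0∞, K ≠ ∞ ∧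
    ∀ {X : Type*} [MeasureSpace X] (F : Finset (Set X)), IsNested (F : Set (Set X)) →
      (∀ Q ∈ F, MeasurableSet Q) → IsSparse (F : Set (Set X)) →
      (∀ Q ∈ F, volume Q ≠ 0 ∧ volume Q ≠ ∞) → ∀ h : X → ℝ≥0∞, Measurable h →
      ∑ Q ∈ F, volume Q * (⨍⁻ x in Q, h x ∂volume) ^ q ≤ K * ∫⁻ x in ⋃ Q ∈ F, Q, h x ^ q := by
  have ht := three_halves_rpow_neg_lt_one (sub_pos.2 hq)
  set t : ℝ≥0∞ := (3 / 2) ^ (-(q - 1)) with ht_def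
  refine ⟨4 ^ (q - 1) * (1 - t)⁻¹, ?_, ?_⟩
  · have : 1 - t ≠ 0 := (tsub_pos_of_lt ht).ne'
    have : 0 ≤ q - 1 := by linarith
    finiteness
  intro X _ F hF hFm hsp hvol h hh
  have hN := fun Q => measurable_subCount hFm Q
  have hW : ∀ Q, Measurable fun x => t ^ subCount F Q x :=
    fun Q => measurable_from_top.comp (hN Q)
  have key : ∀ Q ∈ F, volume Q * (⨍⁻ x in Q, h x ∂volume) ^ q ≤
      4 ^ (q - 1) * ∫⁻ x in ⋃ Q ∈ F, Q,
        h x ^ q * Q.indicator (fun x => t ^ subCount F Q x) x := by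
    intro Q hQ
    obtain ⟨hQ0, hQt⟩ := hvol Q hQ
    have hH : ∫⁻ x in Q, h x ≤ (∫⁻ x in Q, h x ^ q * t ^ subCount F Q x) ^ (1 / q) *
        (∫⁻ x in Q, (3 / 2) ^ subCount F Q x) ^ (1 - 1 / q) := by
      have hW' : Measurable fun x => (3 / 2 : ℝ≥0∞) ^ subCount F Q x :=
        measurable_from_top.comp (hN Q)
      refine le_trans (le_of_eq ?_) (ENNReal.lintegral_mul_norm_pow_le
        ((hh.pow_const q).mul (hW Q)).aemeasurable hW'.aemeasurable
        (by positivity) (sub_nonneg.2 ((div_le_one (by linarith)).2 hq.le)) (by ring))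
      refine lintegral_congr fun x => ?_
      have h32 : (3 / 2 : ℝ≥0∞) ≠ 0 := by simp
      have h32' : (3 / 2 : ℝ≥0∞) ≠ ∞ := by finiteness
      have hq0 : q ≠ 0 := by linarith
      rw [Pi.mul_apply, ENNReal.mul_rpow_of_nonneg _ _ (by positivity), ← ENNReal.rpow_mul,
        mul_one_div_cancel hq0, ENNReal.rpow_one, mul_assoc, ht_def,
        ← ENNReal.rpow_natCast, ← ENNReal.rpow_natCast, ← ENNReal.rpow_mul, ← ENNReal.rpow_mul,
        ← ENNReal.rpow_mul, ← ENNReal.rpow_add _ _ h32 h32']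
      rw [show -(q - 1) * ((subCount F Q x : ℝ) * (1 / q)) + subCount F Q x * (1 - 1 / q) = 0 by
        field_simp; ring, ENNReal.rpow_zero, mul_one]
    have hH' : (∫⁻ x in Q, h x) ^ q ≤ (∫⁻ x in Q, h x ^ q * t ^ subCount F Q x) *
        (4 * volume Q) ^ (q - 1) := by
      calc (∫⁻ x in Q, h x) ^ q
          ≤ ((∫⁻ x in Q, h x ^ q * t ^ subCount F Q x) ^ (1 / q) *
            (∫⁻ x in Q, (3 / 2) ^ subCount F Q x) ^ (1 - 1 / q)) ^ q := by gcongr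
        _ = (∫⁻ x in Q, h x ^ q * t ^ subCount F Q x) *
            (∫⁻ x in Q, (3 / 2) ^ subCount F Q x) ^ (q - 1) := by
            rw [ENNReal.mul_rpow_of_nonneg _ _ (by linarith), ← ENNReal.rpow_mul,
              ← ENNReal.rpow_mul, one_div_mul_cancel (by linarith), ENNReal.rpow_one,
              sub_mul, one_div_mul_cancel (by linarith), one_mul]
        _ ≤ _ := by
            gcongr
            exact setLIntegral_pow_subCount_le hF hFm hsp hQ
    calc volume Q * (⨍⁻ x in Q, h x ∂volume) ^ q
        = volume Q * ((∫⁻ x in Q, h x) ^ q * volume Q ^ (-q)) := by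
          rw [setLAverage_eq, div_eq_mul_inv, ENNReal.mul_rpow_of_nonneg _ _ (by linarith),
            ENNReal.inv_rpow, ENNReal.rpow_neg]
      _ ≤ volume Q * ((∫⁻ x in Q, h x ^ q * t ^ subCount F Q x) *
          (4 * volume Q) ^ (q - 1) * volume Q ^ (-q)) := by gcongr
      _ = 4 ^ (q - 1) * (∫⁻ x in Q, h x ^ q * t ^ subCount F Q x) *
          (volume Q ^ (1 : ℝ) * volume Q ^ (q - 1) * volume Q ^ (-q)) := by
          rw [ENNReal.mul_rpow_of_nonneg _ _ (by linarith), ENNReal.rpow_one]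
          ring
      _ = 4 ^ (q - 1) * (∫⁻ x in Q, h x ^ q * t ^ subCount F Q x) := by
          rw [← ENNReal.rpow_add _ _ hQ0 hQt, ← ENNReal.rpow_add _ _ hQ0 hQt,
            show 1 + (q - 1) + -q = 0 by ring, ENNReal.rpow_zero, mul_one]
      _ = 4 ^ (q - 1) * ∫⁻ x in ⋃ Q ∈ F, Q,
          h x ^ q * Q.indicator (fun x => t ^ subCount F Q x) x := by
          congr 1
          rw [← lintegral_indicator (hFm Q hQ), ← lintegral_indicator
            (Finset.measurableSet_biUnion F hFm)]
          refine lintegral_congr fun x => ?_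
          by_cases hx : x ∈ Q
          · have : x ∈ ⋃ Q ∈ F, Q := Set.mem_biUnion hQ hx
            simp only [Set.indicator_of_mem hx, Set.indicator_of_mem this]
          · by_cases hx' : x ∈ ⋃ Q ∈ F, Q
            · simp only [Set.indicator_of_notMem hx, Set.indicator_of_mem hx', mul_zero]
            · simp only [Set.indicator_of_notMem hx, Set.indicator_of_notMem hx']
  calc ∑ Q ∈ F, volume Q * (⨍⁻ x in Q, h x ∂volume) ^ q
      ≤ ∑ Q ∈ F, 4 ^ (q - 1) * ∫⁻ x in ⋃ Q ∈ F, Q,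
        h x ^ q * Q.indicator (fun x => t ^ subCount F Q x) x := Finset.sum_le_sum key
    _ = 4 ^ (q - 1) * ∫⁻ x in ⋃ Q ∈ F, Q,
        h x ^ q * ∑ Q ∈ F, Q.indicator (fun x => t ^ subCount F Q x) x := by
        rw [← Finset.mul_sum, ← lintegral_finsetSum]
        · simp_rw [Finset.mul_sum]
        · exact fun Q hQ => (hh.pow_const q).mul ((hW Q).indicator (hFm Q hQ))
    _ ≤ 4 ^ (q - 1) * ∫⁻ x in ⋃ Q ∈ F, Q, h x ^ q * (1 - t)⁻¹ := by
        gcongr with x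
        exact sum_pow_subCount_le hF t x
    _ = _ := by
        rw [lintegral_mul_const _ (hh.pow_const q)]
        ring

/-- Dual form of the Carleson embedding: an `L^u` bound for sums over a nested sparse family. -/
theorem exists_lintegral_sum_indicator_rpow_le {u : ℝ} (hu : 1 < u) : ∃ K : ℝ≥0∞, K ≠ ∞ ∧
    ∀ {X : Type*} [MeasureSpace X] (F : Finset (Set X)), IsNested (F : Set (Set X)) →
      (∀ Q ∈ F, MeasurableSet Q) → IsSparse (F : Set (Set X)) → ∀ b : Set X → ℝ≥0∞,
      ∫⁻ x, (∑ Q ∈ F, Q.indicator (fun _ => b Q) x) ^ u ≤ K * ∑ Q ∈ F, volume Q * b Q ^ u := by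
  have hu' : 0 < u - 1 := by linarith
  have ht := three_halves_rpow_neg_lt_one (one_div_pos.2 hu')
  set t : ℝ≥0∞ := (3 / 2) ^ (-(1 / (u - 1))) with ht_def
  refine ⟨((1 - t)⁻¹) ^ (u - 1) * 4, ?_, ?_⟩
  · have : 1 - t ≠ 0 := (tsub_pos_of_lt ht).ne'
    finiteness
  intro X _ F hF hFm hsp b
  have h32 : (3 / 2 : ℝ≥0∞) ≠ 0 := by simp
  have h32' : (3 / 2 : ℝ≥0∞) ≠ ∞ := by finiteness
  have ht0 : t ≠ 0 := (ENNReal.rpow_pos (pos_iff_ne_zero.2 h32) h32').ne'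
  have htt : t ≠ ∞ := (ht.trans one_lt_top).ne
  have hpt : ∀ x, (∑ Q ∈ F, Q.indicator (fun _ => b Q) x) ^ u ≤ ((1 - t)⁻¹) ^ (u - 1) *
      ∑ Q ∈ F, Q.indicator (fun x => b Q ^ u * (3 / 2) ^ subCount F Q x) x := by
    intro x
    have hH := ENNReal.inner_le_weight_mul_Lp_of_nonneg F hu.le
      (fun Q => Q.indicator (fun x => t ^ subCount F Q x) x)
      (fun Q => Q.indicator (fun x => b Q * (t ^ subCount F Q x)⁻¹) x)
    have e1 : ∀ Q ∈ F, Q.indicator (fun x => t ^ subCount F Q x) x *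
        Q.indicator (fun x => b Q * (t ^ subCount F Q x)⁻¹) x = Q.indicator (fun _ => b Q) x := by
      intro Q _
      by_cases hx : x ∈ Q
      · simp only [Set.indicator_of_mem hx]
        rw [mul_left_comm, ENNReal.mul_inv_cancel (pow_ne_zero _ ht0) (pow_ne_top htt), mul_one]
      · simp [hx]
    have e2 : ∀ Q ∈ F, Q.indicator (fun x => t ^ subCount F Q x) x *
        Q.indicator (fun x => b Q * (t ^ subCount F Q x)⁻¹) x ^ u =
        Q.indicator (fun x => b Q ^ u * (3 / 2) ^ subCount F Q x) x := by
      intro Q _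
      by_cases hx : x ∈ Q
      · simp only [Set.indicator_of_mem hx]
        rw [ENNReal.mul_rpow_of_nonneg _ _ (by linarith), mul_left_comm]
        congr 1
        rw [ht_def, ← ENNReal.rpow_natCast, ← ENNReal.rpow_natCast, ← ENNReal.rpow_mul,
          ← ENNReal.rpow_neg, ← ENNReal.rpow_mul, ← ENNReal.rpow_add _ _ h32 h32']
        congr 1
        field_simp
        ring
      · simp [hx]
    rw [Finset.sum_congr rfl e1, Finset.sum_congr rfl e2] at hH
    calc (∑ Q ∈ F, Q.indicator (fun _ => b Q) x) ^ u
        ≤ ((∑ Q ∈ F, Q.indicator (fun x => t ^ subCount F Q x) x) ^ (1 - u⁻¹) *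
          (∑ Q ∈ F, Q.indicator (fun x => b Q ^ u * (3 / 2) ^ subCount F Q x) x) ^ u⁻¹) ^ u := by
          gcongr
      _ = (∑ Q ∈ F, Q.indicator (fun x => t ^ subCount F Q x) x) ^ (u - 1) *
          ∑ Q ∈ F, Q.indicator (fun x => b Q ^ u * (3 / 2) ^ subCount F Q x) x := by
          rw [ENNReal.mul_rpow_of_nonneg _ _ (by linarith), ← ENNReal.rpow_mul,
            ← ENNReal.rpow_mul, inv_mul_cancel₀ (by linarith), ENNReal.rpow_one,
            sub_mul, inv_mul_cancel₀ (by linarith), one_mul]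
      _ ≤ _ := by
          gcongr
          exact sum_pow_subCount_le hF t x
  have hW : ∀ Q, Measurable fun x => (3 / 2 : ℝ≥0∞) ^ subCount F Q x :=
    fun Q => measurable_from_top.comp (measurable_subCount hFm Q)
  have hWi : ∀ Q ∈ F, Measurable fun x =>
      Q.indicator (fun x => b Q ^ u * (3 / 2 : ℝ≥0∞) ^ subCount F Q x) x :=
    fun Q hQ => ((hW Q).const_mul _).indicator (hFm Q hQ)
  calc ∫⁻ x, (∑ Q ∈ F, Q.indicator (fun _ => b Q) x) ^ u
      ≤ ∫⁻ x, ((1 - t)⁻¹) ^ (u - 1) *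
        ∑ Q ∈ F, Q.indicator (fun x => b Q ^ u * (3 / 2) ^ subCount F Q x) x :=
        lintegral_mono hpt
    _ = ((1 - t)⁻¹) ^ (u - 1) * ∑ Q ∈ F, b Q ^ u * ∫⁻ x in Q, (3 / 2) ^ subCount F Q x := by
        rw [lintegral_const_mul _ (Finset.measurable_fun_sum _ hWi), lintegral_finsetSum _ hWi]
        congr 1
        refine Finset.sum_congr rfl fun Q hQ => ?_
        rw [lintegral_indicator (hFm Q hQ), lintegral_const_mul _ (hW Q)]
    _ ≤ ((1 - t)⁻¹) ^ (u - 1) * ∑ Q ∈ F, b Q ^ u * (4 * volume Q) := by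
        gcongr with Q hQ
        exact setLIntegral_pow_subCount_le hF hFm hsp hQ
    _ = _ := by
        rw [mul_assoc, Finset.mul_sum (a := 4)]
        congr 1
        exact Finset.sum_congr rfl fun Q _ => by ring

theorem dyadicCube_eq_pi (n : ℕ) (k : ℤ) (m : Fin n → ℤ) :
    dyadicCube n k m =
      Set.univ.pi fun i => Set.Ico ((2 : ℝ) ^ (-k) * m i) ((2 : ℝ) ^ (-k) * (m i + 1)) := by
  ext x
  simp [dyadicCube]

theorem IsDyadicCube.measurableSet {n : ℕ} {Q : Set (Fin n → ℝ)} (hQ : IsDyadicCube n Q) :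
    MeasurableSet Q := by
  obtain ⟨k, m, rfl⟩ := hQ
  rw [dyadicCube_eq_pi]
  exact MeasurableSet.univ_pi fun i => measurableSet_Ico

theorem volume_dyadicCube (n : ℕ) (k : ℤ) (m : Fin n → ℤ) :
    volume (dyadicCube n k m) = ENNReal.ofReal ((2 : ℝ) ^ (-k)) ^ n := by
  rw [dyadicCube_eq_pi, Real.volume_pi_Ico]
  simp [mul_add]

theorem IsDyadicCube.volume_ne_zero {n : ℕ} {Q : Set (Fin n → ℝ)} (hQ : IsDyadicCube n Q) :
    volume Q ≠ 0 := by
  obtain ⟨k, m, rfl⟩ := hQ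
  rw [volume_dyadicCube]
  exact pow_ne_zero _ (ENNReal.ofReal_pos.2 (by positivity)).ne'

theorem IsDyadicCube.volume_ne_top {n : ℕ} {Q : Set (Fin n → ℝ)} (hQ : IsDyadicCube n Q) :
    volume Q ≠ ∞ := by
  obtain ⟨k, m, rfl⟩ := hQ
  rw [volume_dyadicCube]
  finiteness

theorem level_le_of_dyadicCube_subset {n : ℕ} (hn : n ≠ 0) {k l : ℤ} {m m' : Fin n → ℤ}
    (h : dyadicCube n k m ⊆ dyadicCube n l m') : l ≤ k := by
  have hv := measure_mono (μ := volume) h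
  rw [volume_dyadicCube, volume_dyadicCube, ENNReal.pow_le_pow_left_iff hn,
    ENNReal.ofReal_le_ofReal_iff (by positivity),
    zpow_le_zpow_iff_right₀ (by norm_num : (1 : ℝ) < 2)] at hv
  omega

theorem dyadicCube_subset_of_mem {n : ℕ} {k l : ℤ} (hkl : k ≤ l) {m m' : Fin n → ℤ}
    {x : Fin n → ℝ} (h : x ∈ dyadicCube n k m) (h' : x ∈ dyadicCube n l m') :
    dyadicCube n l m' ⊆ dyadicCube n k m := by
  obtain ⟨d, rfl⟩ := Int.le.dest hkl
  have hpos : (0 : ℝ) < 2 ^ (-(k + d)) := by positivity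
  have hk : (2 : ℝ) ^ (-k) = 2 ^ (-(k + d)) * ((2 ^ d : ℤ) : ℝ) := by
    rw [neg_add, zpow_add₀ two_ne_zero, zpow_neg _ (d : ℤ)]
    push_cast
    rw [zpow_natCast, mul_assoc, inv_mul_cancel₀ (by positivity), mul_one]
  intro y hy i
  obtain ⟨h1, h2⟩ := h i
  obtain ⟨h1', h2'⟩ := h' i
  obtain ⟨h3, h4⟩ := hy i
  rw [hk] at h1 h2 ⊢
  have e1 : (2 ^ d : ℤ) * m i < m' i + 1 := by
    have := lt_of_le_of_lt h1 h2'
    rw [mul_assoc] at this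
    exact_mod_cast lt_of_mul_lt_mul_left this hpos.le
  have e2 : m' i < (2 ^ d : ℤ) * (m i + 1) := by
    have := lt_of_le_of_lt h1' h2
    rw [mul_assoc] at this
    exact_mod_cast lt_of_mul_lt_mul_left this hpos.le
  have e1' : ((2 ^ d : ℤ) : ℝ) * m i ≤ m' i := by exact_mod_cast Int.lt_add_one_iff.1 e1
  have e2' : (m' i : ℝ) + 1 ≤ ((2 ^ d : ℤ) : ℝ) * (m i + 1) := by exact_mod_cast e2
  rw [mul_assoc, mul_assoc]
  exact ⟨(mul_le_mul_of_nonneg_left e1' hpos.le).trans h3,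
    h4.trans_le (mul_le_mul_of_nonneg_left e2' hpos.le)⟩

theorem isNested_of_isDyadicCube {n : ℕ} {S : Set (Set (Fin n → ℝ))}
    (hS : ∀ Q ∈ S, IsDyadicCube n Q) : IsNested S := by
  intro P hP Q hQ x hxP hxQ
  obtain ⟨k, m, rfl⟩ := hS P hP
  obtain ⟨l, m', rfl⟩ := hS Q hQ
  rcases le_total k l with h | h
  · exact Or.inr (dyadicCube_subset_of_mem h hxP hxQ)
  · exact Or.inl (dyadicCube_subset_of_mem h hxQ hxP)

/-- The members of `S` that are dyadic cubes of level at most `N`. -/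
def levelTrunc (n : ℕ) (S : Set (Set (Fin n → ℝ))) (N : ℤ) : Set (Set (Fin n → ℝ)) :=
  {Q | Q ∈ S ∧ ∃ k ≤ N, ∃ m, Q = dyadicCube n k m}

theorem levelTrunc_mono (n : ℕ) (S : Set (Set (Fin n → ℝ))) : Monotone (levelTrunc n S) :=
  fun _ _ h _ hQ => ⟨hQ.1, hQ.2.imp fun _ hk => ⟨hk.1.trans h, hk.2⟩⟩

theorem finite_levelTrunc {n : ℕ} (hn : n ≠ 0) {Q₀ : Set (Fin n → ℝ)} (hQ₀ : IsDyadicCube n Q₀)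
    {S : Set (Set (Fin n → ℝ))} (hS : ∀ Q ∈ S, Q ⊆ Q₀) (N : ℤ) : (levelTrunc n S N).Finite := by
  obtain ⟨k₀, m₀, rfl⟩ := hQ₀
  have hfin : ∀ k : ℤ, {m : Fin n → ℤ | dyadicCube n k m ⊆ dyadicCube n k₀ m₀}.Finite := by
    intro k
    refine (Set.finite_Icc (fun i => ⌊(2 : ℝ) ^ k * (2 ^ (-k₀) * m₀ i)⌋)
      (fun i => ⌈(2 : ℝ) ^ k * (2 ^ (-k₀) * (m₀ i + 1))⌉)).subset fun m hm => ?_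
    have hmem : (fun i => (2 : ℝ) ^ (-k) * m i) ∈ dyadicCube n k m := fun i =>
      ⟨le_rfl, mul_lt_mul_of_pos_left (by linarith) (by positivity)⟩
    have hc : ∀ i, (m i : ℝ) = 2 ^ k * (2 ^ (-k) * m i) := fun i => by
      rw [← mul_assoc, ← zpow_add₀ two_ne_zero, add_neg_cancel, zpow_zero, one_mul]
    refine ⟨fun i => ?_, fun i => ?_⟩
    · have h := (hm hmem i).1
      refine Int.cast_le.1 ((Int.floor_le _).trans ?_ : _ ≤ (m i : ℝ))
      rw [hc i]
      gcongr
    · have h := (hm hmem i).2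
      refine Int.cast_le.1 (le_trans ?_ (Int.le_ceil _) : (m i : ℝ) ≤ _)
      rw [hc i]
      gcongr
  refine ((Set.finite_Icc k₀ N).biUnion fun k _ => (hfin k).image (dyadicCube n k)).subset ?_
  rintro Q ⟨hQS, k, hk, m, rfl⟩
  have hsub := hS _ hQS
  exact Set.mem_biUnion (x := k) ⟨level_le_of_dyadicCube_subset hn hsub, hk⟩ ⟨m, hsub, rfl⟩

theorem isSparse_levelTrunc {n : ℕ} (hn : n ≠ 0) {S : Set (Set (Fin n → ℝ))}
    (hS : ∀ Q ∈ S, IsDyadicCube n Q) (hsp : IsSparse S) (N : ℤ) :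
    IsSparse (levelTrunc n S N) := by
  intro Q hQ
  refine le_trans ?_ (hsp Q hQ.1)
  have hsub : sparseMaximals (levelTrunc n S N) Q ⊆ sparseMaximals S Q := by
    rintro P ⟨⟨hPS, k, hk, m, rfl⟩, hPQ, hmax⟩
    refine ⟨hPS, hPQ, fun R hR hRQ hPR => hmax R ⟨hR, ?_⟩ hRQ hPR⟩
    obtain ⟨l, m', rfl⟩ := hS R hR
    exact ⟨l, (level_le_of_dyadicCube_subset hn hPR).trans hk, m', rfl⟩
  exact ENNReal.tsum_mono_subtype (fun P => volume P) hsub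

theorem setLAverage_rpow_le {X : Type*} [MeasurableSpace X] {μ : Measure X} {Q : Set X}
    (h0 : μ Q ≠ 0) (ht : μ Q ≠ ∞) {f : X → ℝ≥0∞} (hf : Measurable f) {s : ℝ} (hs : 1 ≤ s) :
    (⨍⁻ x in Q, f x ∂μ) ^ s ≤ ⨍⁻ x in Q, f x ^ s ∂μ := by
  have hs0 : 0 < s := by linarith
  have hH := ENNReal.lintegral_mul_norm_pow_le (μ := μ.restrict Q) (f := fun x => f x ^ s)
    (g := fun _ => 1) (hf.pow_const s).aemeasurable aemeasurable_const
    (p := 1 / s) (q := 1 - 1 / s) (by positivity)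
    (sub_nonneg.2 ((div_le_one hs0).2 hs)) (by ring)
  simp only [← ENNReal.rpow_mul, mul_one_div_cancel hs0.ne', ENNReal.rpow_one, ENNReal.one_rpow,
    mul_one, lintegral_const, Measure.restrict_apply, MeasurableSet.univ, Set.univ_inter,
    one_mul] at hH
  rw [setLAverage_eq, setLAverage_eq]
  calc ((∫⁻ x in Q, f x ∂μ) / μ Q) ^ s
      ≤ ((∫⁻ x in Q, f x ^ s ∂μ) ^ (1 / s) * μ Q ^ (1 - 1 / s) / μ Q) ^ s := by gcongr
    _ = (∫⁻ x in Q, f x ^ s ∂μ) * (μ Q ^ (s - 1) * μ Q ^ (-s)) := by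
        rw [div_eq_mul_inv, ENNReal.mul_rpow_of_nonneg _ _ hs0.le,
          ENNReal.mul_rpow_of_nonneg _ _ hs0.le, ← ENNReal.rpow_mul, ← ENNReal.rpow_mul,
          one_div_mul_cancel hs0.ne', ENNReal.rpow_one, sub_mul, one_div_mul_cancel hs0.ne',
          one_mul, ENNReal.inv_rpow, ENNReal.rpow_neg, mul_assoc]
    _ = (∫⁻ x in Q, f x ^ s ∂μ) / μ Q := by
        rw [← ENNReal.rpow_add _ _ h0 ht, show s - 1 + -s = -1 by ring, ENNReal.rpow_neg_one,
          div_eq_mul_inv]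

theorem rpow_le_max_one_rpow {t a b : ℝ} (ht : 0 < t) (ha : 0 ≤ a) (hab : a ≤ b) :
    t ^ a ≤ max 1 (t ^ b) := by
  rcases le_total t 1 with h | h
  · exact le_max_of_le_left (Real.rpow_le_one ht.le h ha)
  · exact le_max_of_le_right (Real.rpow_le_rpow_of_exponent_le h hab)

/-- The numerical form of the `ε^αLH₀` condition. -/
theorem rpow_mul_div_rpow_le {V e α A E C₀ δ d : ℝ} (hV : 0 < V) (he : 0 < e) (hα : 0 ≤ α)
    (hα1 : α ≤ 1) (hA : 1 ≤ A) (hE : 1 ≤ E) (heE : e ≤ E) (hδ0 : 0 ≤ δ) (hδ1 : δ ≤ 1)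
    (hδd : δ ≤ d) (hC : (V / e ^ α) ^ (-d) ≤ C₀) :
    e ^ α * (A / V) ^ δ ≤ A * max 1 C₀ * E := by
  have heα : 0 < e ^ α := by positivity
  have h1 : (e ^ α / V) ^ δ ≤ max 1 C₀ := by
    refine (rpow_le_max_one_rpow (by positivity) hδ0 hδd).trans (max_le_max_left _ ?_)
    rwa [Real.rpow_neg (by positivity), ← Real.inv_rpow (by positivity), inv_div] at hC
  have h2 : A ^ δ ≤ A := by
    simpa using Real.rpow_le_rpow_of_exponent_le hA hδ1
  have h3 : (e ^ α) ^ (1 - δ) ≤ E := by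
    calc (e ^ α) ^ (1 - δ) = e ^ (α * (1 - δ)) := by rw [Real.rpow_mul he.le]
      _ ≤ E ^ (α * (1 - δ)) := by
          exact Real.rpow_le_rpow he.le heE (mul_nonneg hα (by linarith))
      _ ≤ E ^ (1 : ℝ) := Real.rpow_le_rpow_of_exponent_le hE (by nlinarith)
      _ = E := Real.rpow_one E
  calc e ^ α * (A / V) ^ δ = A ^ δ * (e ^ α / V) ^ δ * (e ^ α) ^ (1 - δ) := by
        rw [Real.div_rpow (by linarith) hV.le, Real.div_rpow heα.le hV.le,
          Real.rpow_sub heα, Real.rpow_one]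
        field_simp
    _ ≤ A * max 1 C₀ * E := by gcongr

/-- Pointwise comparison of the average of `H` with the average of `H ^ (p(·) / q)`. -/
theorem ofReal_rpow_mul_setLAverage_le {X : Type*} [MeasurableSpace X] {μ : Measure X} {Q : Set X}
    (h0 : μ Q ≠ 0) (ht : μ Q ≠ ∞) {p : X → ℝ} (hp : Measurable p) {H : X → ℝ≥0∞}
    (hH : Measurable H) (hH1 : ∀ x, 1 ≤ H x) {A : ℝ} (hA : 1 ≤ A)
    (hHA : ∫⁻ x in Q, H x ^ p x ∂μ ≤ ENNReal.ofReal A) {q P P' e α E C₀ : ℝ} (hq : 1 < q)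
    (hqP : q ≤ P) (hPp : ∀ᵐ x ∂μ.restrict Q, P ≤ p x) (he : 0 < e) (heE : e ≤ E) (hE : 1 ≤ E)
    (hα : 0 ≤ α) (hα1 : α ≤ 1) (hC : ((μ Q).toReal / e ^ α) ^ (P - P') ≤ C₀)
    {s : ℝ} (hPs : P ≤ s) (hsP' : s ≤ P') :
    ENNReal.ofReal (e ^ α) * ⨍⁻ x in Q, H x ∂μ ≤
      ENNReal.ofReal (A * max 1 C₀ * E) * (⨍⁻ x in Q, H x ^ (p x / q) ∂μ) ^ (q / s) := by
  have hq0 : 0 < q := by linarith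
  have hP0 : 0 < P := by linarith
  have hs0 : 0 < s := by linarith
  have hV : 0 < (μ Q).toReal := ENNReal.toReal_pos h0 ht
  have hh : Measurable fun x => H x ^ (p x / q) := hH.pow (hp.div_const q)
  set c := ⨍⁻ x in Q, H x ^ (p x / q) ∂μ with hc
  have hcq : c ^ q ≤ ENNReal.ofReal (A / (μ Q).toReal) := by
    calc c ^ q ≤ ⨍⁻ x in Q, (H x ^ (p x / q)) ^ q ∂μ := setLAverage_rpow_le h0 ht hh hq.le
      _ = (∫⁻ x in Q, H x ^ p x ∂μ) / μ Q := by
          rw [setLAverage_eq]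
          simp_rw [← ENNReal.rpow_mul, div_mul_cancel₀ _ hq0.ne']
      _ ≤ ENNReal.ofReal A / μ Q := by gcongr
      _ = ENNReal.ofReal (A / (μ Q).toReal) := by
          rw [ENNReal.ofReal_div_of_pos hV, ENNReal.ofReal_toReal ht]
  have hHc : (⨍⁻ x in Q, H x ∂μ) ^ (P / q) ≤ c := by
    refine (setLAverage_rpow_le h0 ht hH ((one_le_div hq0).2 hqP)).trans ?_
    rw [hc, setLAverage_eq, setLAverage_eq]
    gcongr ?_ / _
    refine lintegral_mono_ae (hPp.mono fun x hx => ?_)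
    exact ENNReal.rpow_le_rpow_of_exponent_le (hH1 x) (by gcongr)
  have hHc' : ⨍⁻ x in Q, H x ∂μ ≤ c ^ (q / P) := by
    calc ⨍⁻ x in Q, H x ∂μ = ((⨍⁻ x in Q, H x ∂μ) ^ (P / q)) ^ (q / P) := by
          rw [← ENNReal.rpow_mul, div_mul_div_cancel₀ hq0.ne', div_self hP0.ne',
            ENNReal.rpow_one]
      _ ≤ c ^ (q / P) := by gcongr
  have hδ0 : 0 ≤ 1 / P - 1 / s := sub_nonneg.2 (one_div_le_one_div_of_le hP0 hPs)
  have hδ1 : 1 / P - 1 / s ≤ 1 := by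
    have : 1 / P ≤ 1 := (div_le_one hP0).2 (by linarith)
    have : 0 < 1 / s := by positivity
    linarith
  have hδd : 1 / P - 1 / s ≤ P' - P := by
    rw [div_sub_div _ _ hP0.ne' hs0.ne', div_le_iff₀ (by positivity)]
    have : 1 ≤ P * s := by nlinarith
    nlinarith
  have hnum := rpow_mul_div_rpow_le hV he hα hα1 hA hE heE hδ0 hδ1 hδd
    (show _ ≤ C₀ by rwa [neg_sub])
  have hsplit : c ^ (q / P) = c ^ (q / s) * (c ^ q) ^ (1 / P - 1 / s) := by
    rw [← ENNReal.rpow_mul, ← ENNReal.rpow_add_of_nonneg _ _ (by positivity) (by positivity)]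
    congr 1
    field_simp
    ring
  calc ENNReal.ofReal (e ^ α) * ⨍⁻ x in Q, H x ∂μ
      ≤ ENNReal.ofReal (e ^ α) *
        (c ^ (q / s) * ENNReal.ofReal (A / (μ Q).toReal) ^ (1 / P - 1 / s)) := by
        rw [hsplit] at hHc'
        refine mul_le_mul_right (hHc'.trans ?_) _
        gcongr
    _ = ENNReal.ofReal (e ^ α * (A / (μ Q).toReal) ^ (1 / P - 1 / s)) * c ^ (q / s) := by
        rw [ENNReal.ofReal_mul (by positivity), ENNReal.ofReal_rpow_of_pos (by positivity)]
        ring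
    _ ≤ _ := by gcongr

theorem sum_rpow_le_rpow_sum {ι : Type*} (s : Finset ι) (f : ι → ℝ≥0∞) {t : ℝ} (ht : 1 ≤ t) :
    ∑ i ∈ s, f i ^ t ≤ (∑ i ∈ s, f i) ^ t := by
  classical
  induction s using Finset.induction_on with
  | empty => simp
  | insert a s ha ih =>
    rw [Finset.sum_insert ha, Finset.sum_insert ha]
    exact (add_le_add_right ih _).trans (ENNReal.add_rpow_le_rpow_add _ _ ht)

/-- The overlap functions of averages along a sparse family of dyadic cubes are bounded in `L^B`. -/
theorem exists_overlap_bound {n : ℕ} (hn : n ≠ 0) {q B : ℝ} (hq : 1 < q) (hB : 1 < B) :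
    ∃ K : ℝ≥0∞, K ≠ ∞ ∧ ∀ {Q₀ : Set (Fin n → ℝ)}, IsDyadicCube n Q₀ →
      ∀ {S : Set (Set (Fin n → ℝ))}, (∀ Q ∈ S, IsDyadicCube n Q ∧ Q ⊆ Q₀) → IsSparse S →
      ∀ h : (Fin n → ℝ) → ℝ≥0∞, Measurable h → ∃ Y : (Fin n → ℝ) → ℝ≥0∞, Measurable Y ∧
        ∫⁻ x, Y x ^ B ≤ K * ∫⁻ x in Q₀, h x ^ q ∧
        ∀ x, ∀ T : Finset (Set (Fin n → ℝ)), (T : Set (Set (Fin n → ℝ))) ⊆ S →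
          ∑ Q ∈ T, Q.indicator (fun _ => (⨍⁻ y in Q, h y ∂volume) ^ (q / B)) x ≤ Y x := by
  classical
  obtain ⟨K₁, hK₁, hcar⟩ := exists_carleson_embedding.{0} hq
  obtain ⟨K₂, hK₂, hdual⟩ := exists_lintegral_sum_indicator_rpow_le.{0} hB
  refine ⟨K₂ * K₁, by finiteness, ?_⟩
  intro Q₀ hQ₀ S hS hsp h hh
  have hB0 : 0 < B := by linarith
  have hfin := fun N : ℤ => finite_levelTrunc hn hQ₀ (fun Q hQ => (hS Q hQ).2) N
  set F : ℕ → Finset (Set (Fin n → ℝ)) := fun N => (hfin N).toFinset with hF_def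
  have hFcoe : ∀ N : ℕ, (F N : Set (Set (Fin n → ℝ))) = levelTrunc n S N := fun N =>
    (hfin N).coe_toFinset
  have hFS : ∀ N, ∀ Q ∈ F N, Q ∈ S := fun N Q hQ => ((hfin N).mem_toFinset.1 hQ).1
  have hFd : ∀ N, ∀ Q ∈ F N, IsDyadicCube n Q := fun N Q hQ => (hS Q (hFS N Q hQ)).1
  have hFmono : Monotone F := fun M N h =>
    Set.Finite.toFinset_mono (levelTrunc_mono n S (by exact_mod_cast h))
  set b : Set (Fin n → ℝ) → ℝ≥0∞ := fun Q => (⨍⁻ y in Q, h y ∂volume) ^ (q / B) with hb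
  set Z : ℕ → (Fin n → ℝ) → ℝ≥0∞ := fun N x =>
    (∑ Q ∈ F N, Q.indicator (fun _ => b Q) x) ^ B with hZ
  have hZm : ∀ N, Measurable (Z N) := fun N => Measurable.pow_const
    (Finset.measurable_fun_sum _ fun Q hQ =>
      measurable_const.indicator (hFd N Q hQ).measurableSet) _
  have hZmono : Monotone Z := fun M N h x =>
    ENNReal.rpow_le_rpow (Finset.sum_le_sum_of_subset (hFmono h)) hB0.le
  have hZint : ∀ N, ∫⁻ x, Z N x ≤ K₂ * K₁ * ∫⁻ x in Q₀, h x ^ q := by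
    intro N
    have hnest : IsNested (F N : Set (Set (Fin n → ℝ))) := isNested_of_isDyadicCube (hFd N)
    have hmeas : ∀ Q ∈ F N, MeasurableSet Q := fun Q hQ => (hFd N Q hQ).measurableSet
    have hspN : IsSparse (F N : Set (Set (Fin n → ℝ))) := by
      rw [hFcoe]
      exact isSparse_levelTrunc hn (fun Q hQ => (hS Q hQ).1) hsp N
    calc ∫⁻ x, Z N x ≤ K₂ * ∑ Q ∈ F N, volume Q * b Q ^ B := hdual (F N) hnest hmeas hspN b
      _ = K₂ * ∑ Q ∈ F N, volume Q * (⨍⁻ y in Q, h y ∂volume) ^ q := by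
          simp_rw [hb, ← ENNReal.rpow_mul, div_mul_cancel₀ _ hB0.ne']
      _ ≤ K₂ * (K₁ * ∫⁻ x in ⋃ Q ∈ F N, Q, h x ^ q) := by
          gcongr
          exact hcar (F N) hnest hmeas hspN
            (fun Q hQ => ⟨(hFd N Q hQ).volume_ne_zero, (hFd N Q hQ).volume_ne_top⟩) h hh
      _ ≤ K₂ * (K₁ * ∫⁻ x in Q₀, h x ^ q) := by
          gcongr
          exact Set.iUnion₂_subset fun Q hQ => (hS Q (hFS N Q hQ)).2
      _ = _ := by rw [mul_assoc]
  refine ⟨fun x => (⨆ N, Z N x) ^ (1 / B), (Measurable.iSup hZm).pow_const _, ?_, ?_⟩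
  · simp_rw [← ENNReal.rpow_mul, one_div_mul_cancel hB0.ne', ENNReal.rpow_one]
    rw [lintegral_iSup hZm hZmono]
    exact iSup_le hZint
  · intro x T hT
    have hlev : ∀ Q ∈ T, ∃ N, Q ∈ F N := by
      intro Q hQ
      obtain ⟨k, m, rfl⟩ := (hS Q (hT hQ)).1
      exact ⟨k.toNat, (hfin _).mem_toFinset.2 ⟨hT hQ, k, Int.self_le_toNat k, m, rfl⟩⟩
    choose! N hN using hlev
    have hTF : T ⊆ F (T.sup N) := fun Q hQ => hFmono (Finset.le_sup hQ) (hN Q hQ)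
    calc ∑ Q ∈ T, Q.indicator (fun _ => b Q) x
        ≤ ∑ Q ∈ F (T.sup N), Q.indicator (fun _ => b Q) x := Finset.sum_le_sum_of_subset hTF
      _ = Z (T.sup N) x ^ (1 / B) := by
          rw [hZ, ← ENNReal.rpow_mul, mul_one_div_cancel hB0.ne', ENNReal.rpow_one]
      _ ≤ _ := ENNReal.rpow_le_rpow (le_iSup (fun N => Z N x) _) (by positivity)

theorem summable_and_enorm_tsum_le {ι : Type*} {a : ι → ℝ} {d : ι → ℝ≥0∞} {κ Y : ℝ≥0∞} {t : ℝ}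
    (ht : 1 ≤ t) (hκ : κ ≠ ∞) (hY : Y ≠ ∞) (had : ∀ i, ‖a i‖ₑ ≤ κ * d i ^ t)
    (hd : ∀ T : Finset ι, ∑ i ∈ T, d i ≤ Y) : Summable a ∧ ‖∑' i, a i‖ₑ ≤ κ * Y ^ t := by
  have h : ∑' i, ‖a i‖ₑ ≤ κ * Y ^ t := by
    rw [ENNReal.tsum_eq_iSup_sum]
    refine iSup_le fun T => ?_
    calc ∑ i ∈ T, ‖a i‖ₑ ≤ ∑ i ∈ T, κ * d i ^ t := Finset.sum_le_sum fun i _ => had i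
      _ ≤ κ * (∑ i ∈ T, d i) ^ t := by
          rw [← Finset.mul_sum]
          gcongr
          exact sum_rpow_le_rpow_sum T d ht
      _ ≤ κ * Y ^ t := by gcongr; exact hd T
  have ht0 : 0 ≤ t := by linarith
  exact ⟨Summable.of_enorm (ne_top_of_le_ne_top (by finiteness) h),
    enorm_tsum_le_tsum_enorm.trans h⟩

theorem ofReal_abs_div_rpow {u r s : ℝ} (hr : 0 < r) (hs : 0 ≤ s) :
    ENNReal.ofReal ((|u| / r) ^ s) = (‖u‖ₑ / ENNReal.ofReal r) ^ s := by
  rw [← ENNReal.ofReal_rpow_of_nonneg (by positivity) hs, ENNReal.ofReal_div_of_pos hr,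
    ← Real.enorm_eq_ofReal_abs]

theorem varLpNorm_le {X : Type*} [MeasurableSpace X] {p : X → ℝ} {μ : Measure X} {f : X → ℝ}
    (hp : ∀ x, 1 ≤ p x) {r : ℝ} (hr : 0 < r)
    (h : ∫⁻ x, (‖f x‖ₑ / ENNReal.ofReal r) ^ p x ∂μ ≤ 1) :
    varLpNorm p μ f ≤ ENNReal.ofReal r := by
  refine sInf_le ⟨r, hr, rfl, ?_⟩
  simpa only [ofReal_abs_div_rpow hr (zero_le_one.trans (hp _))] using h

theorem lintegral_le_one_of_varLpNorm_le_one {X : Type*} [MeasurableSpace X] {p : X → ℝ}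
    {μ : Measure X} {f : X → ℝ} (hp : ∀ x, 1 ≤ p x) (h : varLpNorm p μ f ≤ 1) :
    ∫⁻ x, (‖f x‖ₑ / 2) ^ p x ∂μ ≤ 1 := by
  obtain ⟨l, ⟨r, hr, rfl, hr1⟩, hl⟩ := sInf_lt_iff.1 (h.trans_lt ENNReal.one_lt_two)
  simp only [ofReal_abs_div_rpow hr (zero_le_one.trans (hp _))] at hr1
  refine le_trans (lintegral_mono fun x => ?_) hr1
  have : 0 ≤ p x := zero_le_one.trans (hp x)
  dsimp only
  gcongr

/-- Bounded coefficient vectors give a totally bounded set of step functions. -/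
theorem exists_finset_net {X : Type*} (F : Finset (Set X)) (M : Set X → ℝ) {b : ℝ} (hb : 0 < b) :
    ∃ G : Finset (X → ℝ), ∀ c : Set X → ℝ, (∀ Q ∈ F, |c Q| ≤ M Q) →
      ∃ g ∈ G, ∀ x, |∑ Q ∈ F, Q.indicator (fun _ => c Q) x - g x| ≤ b := by
  classical
  have hcomp : IsCompact (Set.univ.pi fun Q : F => Set.Icc (-M Q) (M Q)) :=
    isCompact_univ_pi fun _ => isCompact_Icc
  obtain ⟨t, ht, hcov⟩ := Metric.totallyBounded_iff.1 hcomp.totallyBounded (b / (F.card + 1))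
    (by positivity)
  refine ⟨ht.toFinset.image fun c x => ∑ Q : F, (Q : Set X).indicator (fun _ => c Q) x,
    fun c hc => ?_⟩
  have hmem : (fun Q : F => c Q) ∈ Set.univ.pi fun Q : F => Set.Icc (-M Q) (M Q) :=
    fun Q _ => abs_le.1 (hc Q Q.2)
  obtain ⟨c', hc', hdist⟩ := Set.mem_iUnion₂.1 (hcov hmem)
  refine ⟨_, Finset.mem_image_of_mem _ (ht.mem_toFinset.2 hc'), fun x => ?_⟩
  rw [← Finset.sum_coe_sort F, ← Finset.sum_sub_distrib]
  calc |∑ Q : F, ((Q : Set X).indicator (fun _ => c Q) x - (Q : Set X).indicator (fun _ => c' Q) x)|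
      ≤ ∑ Q : F, |(Q : Set X).indicator (fun _ => c Q) x -
        (Q : Set X).indicator (fun _ => c' Q) x| := Finset.abs_sum_le_sum_abs _ _
    _ ≤ ∑ Q : F, b / (F.card + 1) := by
        refine Finset.sum_le_sum fun Q _ => ?_
        by_cases hx : x ∈ (Q : Set X)
        · simp only [Set.indicator_of_mem hx]
          exact ((dist_le_pi_dist (fun Q : F => c Q) c' Q).trans_lt hdist).le
        · simp only [Set.indicator_of_notMem hx, sub_zero, abs_zero]
          positivity
    _ = F.card * (b / (F.card + 1)) := by simp
    _ ≤ b := by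
        rw [mul_div_assoc', div_le_iff₀ (by positivity)]
        nlinarith

theorem enorm_sparseOp_coeff_le {X : Type*} [MeasureSpace X] {Q : Set X}
    {e : ℝ} (he : 0 ≤ e) {f : X → ℝ} {H : X → ℝ≥0∞}
    (hfH : ∀ x, ‖f x‖ₑ ≤ 2 * H x) :
    ‖e * (((volume Q).toReal)⁻¹ * ∫ y in Q, f y)‖ₑ ≤
      ENNReal.ofReal e * (2 * ⨍⁻ y in Q, H y ∂volume) := by
  rw [enorm_mul, enorm_mul, Real.enorm_of_nonneg he, Real.enorm_of_nonneg (by positivity)]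
  refine mul_le_mul_right ?_ _
  have h1 : ENNReal.ofReal ((volume Q).toReal)⁻¹ ≤ (volume Q)⁻¹ := by
    rw [← ENNReal.toReal_inv]
    exact ENNReal.ofReal_toReal_le
  calc ENNReal.ofReal ((volume Q).toReal)⁻¹ * ‖∫ y in Q, f y‖ₑ
      ≤ (volume Q)⁻¹ * ∫⁻ y in Q, 2 * H y := by
        gcongr
        exact (enorm_integral_le_lintegral_enorm _).trans (lintegral_mono hfH)
    _ = 2 * ⨍⁻ y in Q, H y ∂volume := by
        rw [lintegral_const_mul' _ _ (by finiteness), setLAverage_eq, div_eq_mul_inv]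
        ring

/-- Pointwise control of the part of the sparse operator left after removing finitely many cubes. -/
theorem enorm_sparseOp_sub_sum_le {X : Type*} [MeasureSpace X] {ε : Set X → ℝ}
    {S : Set (Set X)} {F : Finset (Set X)} (hFS : (F : Set (Set X)) ⊆ S) {f : X → ℝ} {x : X}
    {c : Set X → ℝ≥0∞} {κ Y : ℝ≥0∞} {t : ℝ} (ht : 1 ≤ t) (hκ : κ ≠ ∞) (hY : Y ≠ ∞)
    (hc : ∀ Q ∈ S, Q ∉ F → x ∈ Q →
      ‖ε Q * (((volume Q).toReal)⁻¹ * ∫ y in Q, f y)‖ₑ ≤ κ * c Q ^ t)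
    (hsum : ∀ T : Finset (Set X), (T : Set (Set X)) ⊆ S →
      ∑ Q ∈ T, Q.indicator (fun _ => c Q) x ≤ Y) :
    ‖sparseOp ε S f x - ∑ Q ∈ F, Q.indicator
      (fun _ => ε Q * (((volume Q).toReal)⁻¹ * ∫ y in Q, f y)) x‖ₑ ≤ κ * Y ^ t := by
  classical
  set g : Set X → ℝ := fun Q => Q.indicator
    (fun _ => ε Q * (((volume Q).toReal)⁻¹ * ∫ y in Q, f y)) x with hg
  obtain ⟨hs, hle⟩ := summable_and_enorm_tsum_le (a := (S \ F).indicator g)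
    (d := S.indicator fun Q => Q.indicator (fun _ => c Q) x) ht hκ hY
    (fun Q => by
      by_cases hQ : Q ∈ S \ (F : Set (Set X))
      · by_cases hx : x ∈ Q
        · simpa only [Set.indicator_of_mem hQ, Set.indicator_of_mem hQ.1, hg,
            Set.indicator_of_mem hx] using hc Q hQ.1 hQ.2 hx
        · simp [Set.indicator_of_mem hQ, hg, hx]
      · simp [Set.indicator_of_notMem hQ])
    (fun T => by
      rw [← Finset.sum_filter_add_sum_filter_not T (· ∈ S),
        Finset.sum_congr rfl (fun Q hQ => Set.indicator_of_mem (Finset.mem_filter.1 hQ).2 _),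
        Finset.sum_congr (s₁ := T.filter (· ∉ S)) rfl
          (fun Q hQ => Set.indicator_of_notMem (Finset.mem_filter.1 hQ).2 _),
        Finset.sum_const_zero, add_zero]
      exact hsum _ fun Q hQ => (Finset.mem_filter.1 hQ).2)
  have hF : HasSum ((F : Set (Set X)).indicator g) (∑ Q ∈ F, g Q) := by
    have h := hasSum_sum_of_ne_finset_zero (L := .unconditional _) (s := F)
      (f := (F : Set (Set X)).indicator g)
      fun Q hQ => Set.indicator_of_notMem hQ _
    rwa [Finset.sum_congr rfl (fun Q hQ => Set.indicator_of_mem (Finset.mem_coe.2 hQ) g)] at h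
  have htot : ∑' Q, S.indicator g Q = ∑' Q, (S \ F).indicator g Q + ∑ Q ∈ F, g Q := by
    rw [← (hs.hasSum.add hF).tsum_eq]
    refine tsum_congr fun Q => ?_
    by_cases hQF : Q ∈ F
    · simp [hQF, hFS hQF]
    · by_cases hQS : Q ∈ S <;> simp [hQF, hQS]
  rwa [sparseOp, show ∑' Q : S, g Q = _ from tsum_subtype S g, htot, add_sub_cancel_right]

theorem div_mul_rpow_le {θ θ' : ℝ} (hθ : 0 ≤ θ) (hθ1 : θ ≤ 1) (hθ' : 0 ≤ θ') (hθ1' : θ' ≤ 1)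
    {y v : ℝ≥0∞} {r B s : ℝ} (hr : 0 < r) (hs : 1 ≤ s)
    (hv : v ≤ ENNReal.ofReal (θ * r / 2) * y ^ (B / s) + ENNReal.ofReal (θ' * r / 2)) :
    (v / ENNReal.ofReal r) ^ s ≤ ENNReal.ofReal θ * y ^ B + ENNReal.ofReal θ' := by
  have hs0 : 0 < s := by linarith
  have hr0 : ENNReal.ofReal r ≠ 0 := (ENNReal.ofReal_pos.2 hr).ne'
  set T₁ := ENNReal.ofReal θ * y ^ (B / s) with hT₁
  set T₂ := ENNReal.ofReal θ' with hT₂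
  have h1 : v / ENNReal.ofReal r ≤ max T₁ T₂ := by
    refine ENNReal.div_le_of_le_mul (hv.trans ?_)
    have e : ∀ a : ℝ, 0 ≤ a → ENNReal.ofReal (a * r / 2) =
        ENNReal.ofReal a * (ENNReal.ofReal r * 2⁻¹) := by
      intro a ha
      rw [mul_div_assoc, ENNReal.ofReal_mul ha, ENNReal.ofReal_div_of_pos two_pos,
        ENNReal.ofReal_ofNat, div_eq_mul_inv]
    rw [e θ hθ, e θ' hθ']
    calc ENNReal.ofReal θ * (ENNReal.ofReal r * 2⁻¹) * y ^ (B / s) +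
          ENNReal.ofReal θ' * (ENNReal.ofReal r * 2⁻¹)
        = (T₁ + T₂) * (ENNReal.ofReal r * 2⁻¹) := by rw [hT₁, hT₂]; ring
      _ ≤ (max T₁ T₂ + max T₁ T₂) * (ENNReal.ofReal r * 2⁻¹) := by
          gcongr
          · exact le_max_left _ _
          · exact le_max_right _ _
      _ = max T₁ T₂ * ENNReal.ofReal r * (2 * 2⁻¹) := by ring
      _ = max T₁ T₂ * ENNReal.ofReal r := by
          rw [ENNReal.mul_inv_cancel two_ne_zero ofNat_ne_top, mul_one]
  have hpow : ∀ a : ℝ, a ≤ 1 → ENNReal.ofReal a ^ s ≤ ENNReal.ofReal a := by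
    intro a ha
    simpa using ENNReal.rpow_le_rpow_of_exponent_ge (ENNReal.ofReal_le_one.2 ha) hs
  calc (v / ENNReal.ofReal r) ^ s ≤ max T₁ T₂ ^ s := by gcongr
    _ ≤ T₁ ^ s + T₂ ^ s := by
        rcases max_choice T₁ T₂ with h | h <;> rw [h]
        · exact le_self_add
        · exact le_add_self
    _ ≤ ENNReal.ofReal θ * y ^ B + ENNReal.ofReal θ' := by
        gcongr
        · rw [hT₁, ENNReal.mul_rpow_of_nonneg _ _ hs0.le, ← ENNReal.rpow_mul,
            div_mul_cancel₀ _ hs0.ne']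
          gcongr
          exact hpow θ hθ1
        · exact hpow θ' hθ1'

/-- **Compactness of ε-sparse operators on a dyadic cube (proof of Theorem 1.3).**
Let `Q₀` be a dyadic cube, `ε = {ε_Q}_{Q ∈ 𝒟(Q₀)}` a bounded collection of positive
numbers with the domination property, `0 < α < 1/2`, suppose
`sup {ε_Q : ℓ(Q) < 2^{-N}} → 0` as `N → ∞` and `p ∈ ε^α LH_0(Q₀)` with
`1 < p_- ≤ p_+ < ∞`. Then for every sparse collection `𝒮 ⊆ 𝒟(Q₀)`, the associated
ε-sparse operator `S_ε` is compact on `L^{p(·)}(Q₀)`: the image of the unit ball is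
totally bounded. -/
theorem sparseOp_compact (n : ℕ) (Q₀ : Set (Fin n → ℝ)) (hQ₀ : IsDyadicCube n Q₀)
    (ε : Set (Fin n → ℝ) → ℝ)
    (hεpos : ∀ Q, IsDyadicCube n Q → Q ⊆ Q₀ → 0 < ε Q)
    (hεbdd : ∃ B : ℝ, ∀ Q, IsDyadicCube n Q → Q ⊆ Q₀ → ε Q ≤ B)
    (hεdom : ∀ P Q, IsDyadicCube n P → IsDyadicCube n Q → P ⊆ Q → Q ⊆ Q₀ → ε P ≤ ε Q)
    (α : ℝ) (hα0 : 0 < α) (hα2 : α < 1 / 2)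
    (hεdecay : ∀ η : ℝ, 0 < η → ∃ N : ℕ, ∀ (k : ℤ) (m : Fin n → ℤ),
      dyadicCube n k m ⊆ Q₀ → (2 : ℝ) ^ (-k) < 2 ^ (-(N : ℤ)) →
        ε (dyadicCube n k m) < η)
    (p : (Fin n → ℝ) → ℝ) (hpMeas : Measurable p) (hp1 : ∀ x, 1 ≤ p x)
    (hpminus : 1 < essInf p (volume.restrict Q₀))
    (hpplus : ∃ B : ℝ, ∀ᵐ x ∂volume.restrict Q₀, p x ≤ B)
    (hLH0 : ∃ C0 : ℝ, 0 < C0 ∧ ∀ Q, IsDyadicCube n Q → Q ⊆ Q₀ →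
      ((volume Q).toReal / ε Q ^ α) ^
        (essInf p (volume.restrict Q) - essSup p (volume.restrict Q)) ≤ C0) :
    ∀ S : Set (Set (Fin n → ℝ)), (∀ Q ∈ S, IsDyadicCube n Q ∧ Q ⊆ Q₀) → IsSparse S →
      ∀ η : ℝ, 0 < η → ∃ G : Finset ((Fin n → ℝ) → ℝ),
        ∀ f : (Fin n → ℝ) → ℝ, Measurable f →
          varLpNorm p (volume.restrict Q₀) f ≤ 1 →
          ∃ g ∈ G, varLpNorm p (volume.restrict Q₀)
            (fun x => sparseOp ε S f x - g x) ≤ ENNReal.ofReal η := by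
  classical
  intro S hS hsp η hη
  have hn : n ≠ 0 := by
    rintro rfl
    obtain ⟨k, m, rfl⟩ := hQ₀
    have hpos := hεpos _ ⟨k, m, rfl⟩ subset_rfl
    obtain ⟨N, hN⟩ := hεdecay _ hpos
    have heq : dyadicCube 0 k m = dyadicCube 0 (N + 1) m := by
      ext x
      simp [dyadicCube]
    have h := hN (N + 1) m heq.ge (zpow_lt_zpow_right₀ one_lt_two (by omega))
    rw [← heq] at h
    exact lt_irrefl _ h
  obtain ⟨E₀, hE₀⟩ := hεbdd
  obtain ⟨B₀, hB₀⟩ := hpplus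
  obtain ⟨C₀, -, hLH⟩ := hLH0
  have hSd : ∀ Q ∈ S, IsDyadicCube n Q := fun Q hQ => (hS Q hQ).1
  have hScount : S.Countable := by
    refine (Set.countable_range fun km : ℤ × (Fin n → ℤ) => dyadicCube n km.1 km.2).mono ?_
    intro Q hQ
    obtain ⟨k, m, rfl⟩ := hSd Q hQ
    exact ⟨(k, m), rfl⟩
  have hbelow : ∀ Q : Set (Fin n → ℝ),
      Filter.IsBoundedUnder (· ≥ ·) (ae (volume.restrict Q)) p := fun Q =>
    Filter.isBoundedUnder_of ⟨1, hp1⟩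
  have habove : ∀ Q ⊆ Q₀, Filter.IsBoundedUnder (· ≤ ·) (ae (volume.restrict Q)) p := fun Q hQ =>
    ⟨B₀, Filter.eventually_map.2 (ae_restrict_of_ae_restrict_of_subset hQ hB₀)⟩
  set q := essInf p (volume.restrict Q₀) with hq
  have hq0 : 0 < q := by linarith
  set B := max B₀ 2 with hB
  have hB1 : 1 < B := lt_of_lt_of_le one_lt_two (le_max_right _ _)
  have hqp : ∀ᵐ x ∂volume.restrict Q₀, q ≤ p x := ae_essInf_le (hbelow Q₀)
  have hqess : ∀ Q ∈ S, q ≤ essInf p (volume.restrict Q) := by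
    intro Q hQ
    have : NeZero (volume.restrict Q) :=
      ⟨by simpa using (hSd Q hQ).volume_ne_zero⟩
    exact Filter.le_liminf_of_le (habove Q (hS Q hQ).2).isCoboundedUnder_ge
      (ae_restrict_of_ae_restrict_of_subset (hS Q hQ).2 hqp)
  set E := max E₀ 1 with hE
  set V := (volume Q₀).toReal with hV
  have hV0 : 0 ≤ V := ENNReal.toReal_nonneg
  have hVol : volume Q₀ = ENNReal.ofReal V := (ENNReal.ofReal_toReal hQ₀.volume_ne_top).symm
  set A := 1 + V with hA
  have hA1 : 1 ≤ A := by linarith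
  set D := A * max 1 C₀ * E with hD
  have hD0 : 0 < D := by positivity
  obtain ⟨K, hK, hover⟩ := exists_overlap_bound hn hpminus hB1
  set K' := (K * ENNReal.ofReal A).toReal + 1 with hK'
  have hK'0 : 0 < K' := by positivity
  set θ := min 1 (1 / (2 * K')) with hθ
  have hθ0 : 0 < θ := by positivity
  set θ' := min 1 (1 / (2 * A)) with hθ'
  have hθ'0 : 0 < θ' := by positivity
  have h1α : 0 < 1 - α := by linarith
  set τ := (θ * η / (4 * D)) ^ (1 / (1 - α)) with hτ
  have hτ0 : 0 < τ := by positivity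
  have hτα : τ ^ (1 - α) = θ * η / (4 * D) := by
    rw [hτ, ← Real.rpow_mul (by positivity), one_div_mul_cancel h1α.ne', Real.rpow_one]
  obtain ⟨N, hN⟩ := hεdecay τ hτ0
  have hfin := finite_levelTrunc hn hQ₀ (fun Q hQ => (hS Q hQ).2) (N : ℤ)
  set F := hfin.toFinset with hF
  have hFS : (F : Set (Set (Fin n → ℝ))) ⊆ S := fun Q hQ => (hfin.mem_toFinset.1 hQ).1
  have hsmall : ∀ Q ∈ S, Q ∉ F → ε Q ≤ τ := by
    intro Q hQ hQF
    obtain ⟨k, m, rfl⟩ := hSd Q hQ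
    refine (hN k m (hS _ hQ).2 (zpow_lt_zpow_right₀ one_lt_two ?_)).le
    by_contra hk
    exact hQF (hfin.mem_toFinset.2 ⟨hQ, k, by omega, m, rfl⟩)
  obtain ⟨G, hG⟩ := exists_finset_net F
    (fun Q => (ENNReal.ofReal E * (2 * (ENNReal.ofReal A / volume Q))).toReal)
    (b := θ' * η / 2) (by positivity)
  refine ⟨G, fun f hf hfnorm => ?_⟩
  set H : (Fin n → ℝ) → ℝ≥0∞ := fun x => max (‖f x‖ₑ / 2) 1 with hH
  have hHm : Measurable H := (hf.enorm.div_const 2).max measurable_const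
  have hH1 : ∀ x, 1 ≤ H x := fun x => le_max_right _ _
  have hfH : ∀ x, ‖f x‖ₑ ≤ 2 * H x := fun x => by
    rw [mul_comm]
    exact (ENNReal.div_le_iff two_ne_zero ofNat_ne_top).1 (le_max_left _ _)
  have hHA : ∫⁻ x in Q₀, H x ^ p x ≤ ENNReal.ofReal A := by
    calc ∫⁻ x in Q₀, H x ^ p x ≤ ∫⁻ x in Q₀, ((‖f x‖ₑ / 2) ^ p x + 1) := by
          refine lintegral_mono fun x => ?_
          rcases max_choice (‖f x‖ₑ / 2) 1 with h | h <;> simp only [hH, h]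
          · exact le_self_add
          · rw [ENNReal.one_rpow]
            exact le_add_self
      _ = (∫⁻ x in Q₀, (‖f x‖ₑ / 2) ^ p x) + volume Q₀ := by
          rw [lintegral_add_right _ measurable_const]
          simp
      _ ≤ 1 + volume Q₀ := by
          gcongr
          exact lintegral_le_one_of_varLpNorm_le_one hp1 hfnorm
      _ = ENNReal.ofReal A := by
          rw [hA, ENNReal.ofReal_add zero_le_one hV0, ENNReal.ofReal_one, hVol]
  have hHAQ : ∀ Q ∈ S, ∫⁻ x in Q, H x ^ p x ≤ ENNReal.ofReal A := fun Q hQ =>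
    (lintegral_mono_set (hS Q hQ).2).trans hHA
  set h : (Fin n → ℝ) → ℝ≥0∞ := fun x => H x ^ (p x / q) with hh
  have hhm : Measurable h := hHm.pow (hpMeas.div_const q)
  obtain ⟨Y, hYm, hYint, hYsum⟩ := hover hQ₀ hS hsp h hhm
  have hhq : ∫⁻ x in Q₀, h x ^ q = ∫⁻ x in Q₀, H x ^ p x := by
    simp_rw [hh, ← ENNReal.rpow_mul, div_mul_cancel₀ _ hq0.ne']
  have hYK : ∫⁻ x, Y x ^ B ≤ ENNReal.ofReal K' := by
    calc ∫⁻ x, Y x ^ B ≤ K * ENNReal.ofReal A := hYint.trans (by rw [hhq]; gcongr)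
      _ = ENNReal.ofReal (K * ENNReal.ofReal A).toReal :=
          (ENNReal.ofReal_toReal (by finiteness)).symm
      _ ≤ ENNReal.ofReal K' := by
          gcongr
          linarith
  have hYfin : ∀ᵐ x, Y x ≠ ∞ := by
    filter_upwards [ae_lt_top (hYm.pow_const B)
      (ne_top_of_le_ne_top ENNReal.ofReal_ne_top hYK)] with x hx hx'
    rw [hx', ENNReal.top_rpow_of_pos (by linarith)] at hx
    exact lt_irrefl _ hx
  have hcoeff : ∀ Q ∈ S, ‖ε Q * (((volume Q).toReal)⁻¹ * ∫ y in Q, f y)‖ₑ ≤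
      ENNReal.ofReal (ε Q) * (2 * ⨍⁻ y in Q, H y ∂volume) := fun Q hQ =>
    enorm_sparseOp_coeff_le (hεpos Q (hSd Q hQ) (hS Q hQ).2).le hfH
  obtain ⟨g, hgG, hg⟩ := hG (fun Q => ε Q * (((volume Q).toReal)⁻¹ * ∫ y in Q, f y)) <| by
    intro Q hQF
    have hQ := hFS hQF
    have hQ0 := (hSd Q hQ).volume_ne_zero
    rw [← Real.norm_eq_abs, ← toReal_enorm]
    refine ENNReal.toReal_mono (by finiteness) ((hcoeff Q hQ).trans ?_)
    rw [setLAverage_eq]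
    gcongr
    · exact (hE₀ Q (hSd Q hQ) (hS Q hQ).2).trans (le_max_left _ _)
    · refine (lintegral_mono fun x => ?_).trans (hHAQ Q hQ)
      simpa using ENNReal.rpow_le_rpow_of_exponent_le (hH1 x) (hp1 x)
  refine ⟨g, hgG, varLpNorm_le hp1 hη ?_⟩
  have hess : ∀ᵐ x ∂volume.restrict Q₀, ∀ Q ∈ S, x ∈ Q →
      essInf p (volume.restrict Q) ≤ p x ∧ p x ≤ essSup p (volume.restrict Q) := by
    refine (ae_ball_iff hScount).2 fun Q hQ => ae_restrict_of_ae ?_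
    rw [← ae_restrict_iff' (hSd Q hQ).measurableSet]
    exact (ae_essInf_le (hbelow Q)).and (_root_.ae_le_essSup (habove Q (hS Q hQ).2))
  have hpt : ∀ᵐ x ∂volume.restrict Q₀,
      (‖sparseOp ε S f x - g x‖ₑ / ENNReal.ofReal η) ^ p x ≤
        ENNReal.ofReal θ * Y x ^ B + ENNReal.ofReal θ' := by
    filter_upwards [hess, hqp, hB₀, ae_restrict_of_ae hYfin] with x hx hqx hBx hYx
    have hpx : 0 < p x := by linarith
    refine div_mul_rpow_le hθ0.le (min_le_left _ _) hθ'0.le (min_le_left _ _) hη (hp1 x) ?_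
    have htail := enorm_sparseOp_sub_sum_le (ε := ε) hFS (f := f) (x := x)
      (c := fun Q => (⨍⁻ y in Q, h y ∂volume) ^ (q / B)) (κ := ENNReal.ofReal (θ * η / 2))
      (t := B / p x) ((one_le_div hpx).2 (hBx.trans (le_max_left _ _))) ENNReal.ofReal_ne_top
      hYx ?_ (hYsum x)
    · refine le_trans ?_ (add_le_add htail (?_ : ‖∑ Q ∈ F, Q.indicator
        (fun _ => ε Q * (((volume Q).toReal)⁻¹ * ∫ y in Q, f y)) x - g x‖ₑ ≤ _))
      · refine le_trans (le_of_eq ?_) (enorm_add_le _ _)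
        rw [sub_add_sub_cancel]
      · rw [Real.enorm_eq_ofReal_abs]
        exact ENNReal.ofReal_le_ofReal (hg x)
    · intro Q hQ hQF hxQ
      have hεQ := hεpos Q (hSd Q hQ) (hS Q hQ).2
      have hloc := ofReal_rpow_mul_setLAverage_le (hSd Q hQ).volume_ne_zero
        (hSd Q hQ).volume_ne_top hpMeas hHm hH1 hA1 (hHAQ Q hQ) hpminus (hqess Q hQ)
        (ae_essInf_le (hbelow Q)) hεQ
        ((hE₀ Q (hSd Q hQ) (hS Q hQ).2).trans (le_max_left _ _)) (le_max_right _ _ : 1 ≤ E)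
        hα0.le (by linarith) (hLH Q (hSd Q hQ) (hS Q hQ).2) (hx Q hQ hxQ).1 (hx Q hQ hxQ).2
      calc ‖ε Q * (((volume Q).toReal)⁻¹ * ∫ y in Q, f y)‖ₑ
          ≤ ENNReal.ofReal (ε Q) * (2 * ⨍⁻ y in Q, H y ∂volume) := hcoeff Q hQ
        _ = 2 * ENNReal.ofReal (ε Q ^ (1 - α)) *
            (ENNReal.ofReal (ε Q ^ α) * ⨍⁻ y in Q, H y ∂volume) := by
            have : ε Q = ε Q ^ (1 - α) * ε Q ^ α := by
              rw [← Real.rpow_add hεQ, sub_add_cancel, Real.rpow_one]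
            conv_lhs => rw [this, ENNReal.ofReal_mul (by positivity)]
            ring
        _ ≤ 2 * ENNReal.ofReal (τ ^ (1 - α)) *
            (ENNReal.ofReal D * (⨍⁻ y in Q, h y ∂volume) ^ (q / p x)) := by
            have := hsmall Q hQ hQF
            gcongr
        _ = ENNReal.ofReal (θ * η / 2) * ((⨍⁻ y in Q, h y ∂volume) ^ (q / B)) ^ (B / p x) := by
            rw [← ENNReal.rpow_mul, div_mul_div_cancel₀ (by linarith), ← mul_assoc, hτα,
              ← ENNReal.ofReal_ofNat 2, ← ENNReal.ofReal_mul (by positivity),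
              ← ENNReal.ofReal_mul (by positivity)]
            congr 2
            field_simp
            norm_num
  calc ∫⁻ x in Q₀, (‖sparseOp ε S f x - g x‖ₑ / ENNReal.ofReal η) ^ p x
      ≤ ∫⁻ x in Q₀, (ENNReal.ofReal θ * Y x ^ B + ENNReal.ofReal θ') := lintegral_mono_ae hpt
    _ = ENNReal.ofReal θ * (∫⁻ x in Q₀, Y x ^ B) + ENNReal.ofReal θ' * volume Q₀ := by
        rw [lintegral_add_right _ measurable_const, lintegral_const_mul _ (hYm.pow_const B)]
        simp
    _ ≤ ENNReal.ofReal θ * ENNReal.ofReal K' + ENNReal.ofReal θ' * ENNReal.ofReal V := by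
        rw [hVol]
        gcongr
        exact (setLIntegral_le_lintegral _ _).trans hYK
    _ = ENNReal.ofReal (θ * K' + θ' * V) := by
        rw [← ENNReal.ofReal_mul hθ0.le, ← ENNReal.ofReal_mul hθ'0.le,
          ← ENNReal.ofReal_add (by positivity) (by positivity)]
    _ ≤ 1 := by
        rw [ENNReal.ofReal_le_one]
        have h1 : θ * K' ≤ 1 / 2 := by
          calc θ * K' ≤ 1 / (2 * K') * K' := by gcongr; exact min_le_right _ _
            _ = 1 / 2 := by field_simp
        have h2 : θ' * V ≤ 1 / 2 := by
          calc θ' * V ≤ 1 / (2 * A) * A := by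
                gcongr
                · exact min_le_right _ _
                · linarith
            _ = 1 / 2 := by field_simp
        linarith
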